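/- Let D be a nonempty compact convex subset of a strictly convex Banach space X, let t : D → D be a single-valued mapping and T : D → KC(D) a multivalued mapping, both satisfying conditions (E) and (C_λ) for some λ ∈ (0,1), and suppose t and T commute. Then there exists a point z ∈ D such that z = t(z) ∈ T(z). -/

import Mathlib

open Filter Topology

/-- The Goebel–Kirk inequality for Krasnoselskii-type iterations
`x (n + 1) = (1 - r) • x n + r • y n`. -/
theorem goebel_kirk_inequality {X : Type*} [NormedAddCommGroup X] [NormedSpace ℝ X]
    {r : ℝ} (hr0 : 0 < r) (hr1 : r < 1) {x y : ℕ → X}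
    (hx : ∀ n, x (n + 1) = (1 - r) • x n + r • y n)
    (hy : ∀ n, ‖y n - y (n + 1)‖ ≤ ‖x n - x (n + 1)‖)
    (hanti : Antitone fun n => ‖x n - y n‖) (n i : ℕ) :
    (1 + n * r) * ‖x i - y i‖ ≤ ‖x i - y (i + n)‖ +
      ((1 - r)⁻¹) ^ n * (‖x i - y i‖ - ‖x (i + n) - y (i + n)‖) := by
  have hstep : ∀ k, ‖x k - x (k + 1)‖ = r * ‖x k - y k‖ := by
    intro k
    rw [hx, show x k - ((1 - r) • x k + r • y k) = r • (x k - y k) by module, norm_smul,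
      Real.norm_of_nonneg hr0.le]
  have hq : 0 < 1 - r := by linarith
  induction n generalizing i with
  | zero => simp
  | succ n ih =>
    have hi := ih (i + 1)
    rw [show i + 1 + n = i + (n + 1) by ring] at hi
    have hsum : ∀ m, ‖y i - y (i + m)‖ ≤ m * (r * ‖x i - y i‖) := by
      intro m
      induction m with
      | zero => simp
      | succ m ihm =>
        have h1 := norm_sub_le_norm_sub_add_norm_sub (y i) (y (i + m)) (y (i + m + 1))
        have h2 := hy (i + m)
        rw [hstep] at h2
        have h3 : ‖x (i + m) - y (i + m)‖ ≤ ‖x i - y i‖ := hanti (Nat.le_add_right i m)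
        have h4 := mul_le_mul_of_nonneg_left h3 hr0.le
        push_cast
        rw [← add_assoc]
        linarith
    have hs := hsum (n + 1)
    have hconv : ‖x (i + 1) - y (i + (n + 1))‖ ≤
        (1 - r) * ‖x i - y (i + (n + 1))‖ + r * ‖y i - y (i + (n + 1))‖ := by
      rw [hx, show (1 - r) • x i + r • y i - y (i + (n + 1)) =
        (1 - r) • (x i - y (i + (n + 1))) + r • (y i - y (i + (n + 1))) by module]
      refine (norm_add_le _ _).trans_eq ?_
      rw [norm_smul, norm_smul, Real.norm_of_nonneg hr0.le, Real.norm_of_nonneg hq.le]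
    have hd : ‖x (i + 1) - y (i + 1)‖ ≤ ‖x i - y i‖ := hanti (Nat.le_succ i)
    have hp : 1 + n * r ≤ ((1 - r)⁻¹) ^ n := by
      have h1 : 1 + r ≤ (1 - r)⁻¹ := by
        rw [le_inv_comm₀ (by linarith) hq, ← one_div, le_div_iff₀ (by linarith)]
        nlinarith
      exact (one_add_mul_le_pow (by linarith) n).trans (pow_le_pow_left₀ (by linarith) h1 n)
    have hmul := mul_le_mul_of_nonneg_right hp (sub_nonneg.2 hd)
    have hs' := mul_le_mul_of_nonneg_left hs hr0.le
    rw [← mul_le_mul_iff_right₀ hq, mul_add, pow_succ]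
    have hcancel : ∀ a b : ℝ, (1 - r) * (a * (1 - r)⁻¹ * b) = a * b := by
      intro a b
      field_simp
    rw [hcancel]
    push_cast at *
    nlinarith

/-- Bounded Krasnoselskii-type iterations satisfy `‖x n - y n‖ → 0`. -/
theorem tendsto_norm_sub_of_krasnoselskii {X : Type*} [NormedAddCommGroup X] [NormedSpace ℝ X]
    {r : ℝ} (hr0 : 0 < r) (hr1 : r < 1) {x y : ℕ → X}
    (hx : ∀ n, x (n + 1) = (1 - r) • x n + r • y n)
    (hy : ∀ n, ‖y n - y (n + 1)‖ ≤ ‖x n - x (n + 1)‖)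
    {M : ℝ} (hM : ∀ i j, ‖x i - y j‖ ≤ M) : Tendsto (fun n => ‖x n - y n‖) atTop (𝓝 0) := by
  have hanti : Antitone fun n => ‖x n - y n‖ := by
    refine antitone_nat_of_succ_le fun k => ?_
    have h1 := norm_sub_le_norm_sub_add_norm_sub (x (k + 1)) (y k) (y (k + 1))
    have h2 := hy k
    rw [hx, show x k - ((1 - r) • x k + r • y k) = r • (x k - y k) by module, norm_smul,
      Real.norm_of_nonneg hr0.le] at h2
    have h3 : ‖x (k + 1) - y k‖ = (1 - r) * ‖x k - y k‖ := by
      rw [hx, show (1 - r) • x k + r • y k - y k = (1 - r) • (x k - y k) by module, norm_smul,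
        Real.norm_of_nonneg (by linarith)]
    linarith
  have hbdd : BddBelow (Set.range fun n => ‖x n - y n‖) :=
    ⟨0, by rintro _ ⟨n, rfl⟩; exact norm_nonneg _⟩
  have hlim := tendsto_atTop_ciInf hanti hbdd
  set d := ⨅ n, ‖x n - y n‖
  have hd0 : 0 ≤ d := Real.iInf_nonneg fun n => norm_nonneg _
  have hbound : ∀ n : ℕ, (1 + n * r) * d ≤ M := by
    intro n
    have hR : Tendsto (fun i => M + ((1 - r)⁻¹) ^ n * (‖x i - y i‖ - ‖x (i + n) - y (i + n)‖))
        atTop (𝓝 (M + ((1 - r)⁻¹) ^ n * (d - d))) :=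
      tendsto_const_nhds.add ((hlim.sub (hlim.comp (tendsto_add_atTop_nat n))).const_mul _)
    rw [sub_self, mul_zero, add_zero] at hR
    refine le_of_tendsto_of_tendsto' (hlim.const_mul _) hR fun i => ?_
    have := goebel_kirk_inequality hr0 hr1 hx hy hanti n i
    have := hM i (i + n)
    linarith
  have hzero : d = 0 := by
    by_contra hne
    have hpos : 0 < r * d := mul_pos hr0 (lt_of_le_of_ne hd0 (Ne.symm hne))
    obtain ⟨n, hn⟩ := exists_nat_gt (M / (r * d))
    rw [div_lt_iff₀ hpos] at hn
    nlinarith [hbound n]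
  rwa [hzero] at hlim

/-- A multivalued self-map of a compact convex set with closed values satisfying selection forms
of conditions `(C_l)` and `(E)` has a fixed point. -/
theorem exists_mem_of_conditionC_conditionE {X : Type*} [NormedAddCommGroup X] [NormedSpace ℝ X]
    {F : Set X} (hne : F.Nonempty) (hcp : IsCompact F) (hconv : Convex ℝ F)
    {S : X → Set X} (hSne : ∀ x ∈ F, (S x).Nonempty) (hScl : ∀ x ∈ F, IsClosed (S x))
    (hSsub : ∀ x ∈ F, S x ⊆ F) {l : ℝ} (hl : l ∈ Set.Ioo (0 : ℝ) 1)
    (hC : ∀ x ∈ F, ∀ y ∈ F, ∀ a ∈ S x, l * ‖x - a‖ ≤ ‖x - y‖ → ∃ b ∈ S y, ‖a - b‖ ≤ ‖x - y‖)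
    {μ : ℝ} (hE : ∀ x ∈ F, ∀ y ∈ F, ∀ a ∈ S x, ∃ b ∈ S y, ‖x - b‖ ≤ μ * ‖x - a‖ + ‖x - y‖) :
    ∃ z ∈ F, z ∈ S z := by
  have hnext : ∀ p : {p : X × X // p.1 ∈ F ∧ p.2 ∈ S p.1},
      ∃ q : {p : X × X // p.1 ∈ F ∧ p.2 ∈ S p.1},
        q.1.1 = (1 - l) • p.1.1 + l • p.1.2 ∧ ‖p.1.2 - q.1.2‖ ≤ ‖p.1.1 - q.1.1‖ := by
    rintro ⟨⟨x, a⟩, hxF, haS⟩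
    have hx' : (1 - l) • x + l • a ∈ F :=
      hconv hxF (hSsub x hxF haS) (by linarith [hl.2]) hl.1.le (by ring)
    obtain ⟨b, hb, hab⟩ := hC x hxF _ hx' a haS (by
      rw [show x - ((1 - l) • x + l • a) = l • (x - a) by module, norm_smul,
        Real.norm_of_nonneg hl.1.le])
    exact ⟨⟨(_, b), hx', hb⟩, rfl, hab⟩
  choose next hnext1 hnext2 using hnext
  obtain ⟨x₀, hx₀⟩ := hne
  obtain ⟨a₀, ha₀⟩ := hSne x₀ hx₀
  let u : ℕ → {p : X × X // p.1 ∈ F ∧ p.2 ∈ S p.1} := fun n => next^[n] ⟨(x₀, a₀), hx₀, ha₀⟩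
  have hu : ∀ n, u (n + 1) = next (u n) := fun n => Function.iterate_succ_apply' next n _
  obtain ⟨M, hM⟩ := Metric.isBounded_iff.1 hcp.isBounded
  have hlim : Tendsto (fun n => ‖(u n).1.1 - (u n).1.2‖) atTop (𝓝 0) := by
    refine tendsto_norm_sub_of_krasnoselskii (x := fun n => (u n).1.1) (y := fun n => (u n).1.2)
      hl.1 hl.2 (fun n => ?_) (fun n => ?_) (M := M) fun i j => ?_
    · rw [hu]; exact hnext1 _
    · rw [hu]; exact hnext2 _
    · rw [← dist_eq_norm]
      exact hM (u i).2.1 (hSsub _ (u j).2.1 (u j).2.2)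
  obtain ⟨z, hz, φ, hφ, hφz⟩ := hcp.tendsto_subseq fun n => (u n).2.1
  refine ⟨z, hz, ?_⟩
  choose b hb hbE using fun n => hE _ (u n).2.1 z hz _ (u n).2.2
  have hxz : Tendsto (fun n => ‖(u (φ n)).1.1 - z‖) atTop (𝓝 0) :=
    tendsto_iff_norm_sub_tendsto_zero.1 hφz
  have hbz : Tendsto (fun n => b (φ n)) atTop (𝓝 z) := by
    rw [tendsto_iff_norm_sub_tendsto_zero]
    have hR := (((hlim.comp hφ.tendsto_atTop).const_mul μ).add hxz).add hxz
    rw [mul_zero, add_zero, add_zero] at hR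
    refine squeeze_zero (fun _ => norm_nonneg _) (fun n => ?_) hR
    have h1 := norm_sub_le_norm_sub_add_norm_sub (b (φ n)) (u (φ n)).1.1 z
    rw [norm_sub_rev (b (φ n)) (u (φ n)).1.1] at h1
    exact h1.trans (add_le_add_left (hbE (φ n)) _)
  exact (hScl z hz).mem_of_tendsto hbz (Eventually.of_forall fun n => hb (φ n))

/-- A self-map of a compact convex set satisfying `(C_l)` and `(E)` has a fixed point. -/
theorem exists_fixedPoint_of_conditionC_conditionE {X : Type*} [NormedAddCommGroup X]
    [NormedSpace ℝ X] {K : Set X} (hne : K.Nonempty) (hcp : IsCompact K) (hconv : Convex ℝ K)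
    {t : X → X} (ht : Set.MapsTo t K K) {l : ℝ} (hl : l ∈ Set.Ioo (0 : ℝ) 1)
    (htC : ∀ x ∈ K, ∀ y ∈ K, l * ‖x - t x‖ ≤ ‖x - y‖ → ‖t x - t y‖ ≤ ‖x - y‖)
    {μ : ℝ} (htE : ∀ x ∈ K, ∀ y ∈ K, ‖x - t y‖ ≤ μ * ‖x - t x‖ + ‖x - y‖) :
    ∃ z ∈ K, t z = z := by
  obtain ⟨z, hz, hzt⟩ := exists_mem_of_conditionC_conditionE (S := fun x => {t x}) (μ := μ)
    hne hcp hconv (fun _ _ => Set.singleton_nonempty _) (fun _ _ => isClosed_singleton)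
    (fun x hx => Set.singleton_subset_iff.2 (ht hx)) hl
    (by rintro x hx y hy _ rfl h; exact ⟨_, rfl, htC x hx y hy h⟩)
    (by rintro x hx y hy _ rfl; exact ⟨_, rfl, htE x hx y hy⟩)
  exact ⟨z, hz, (Set.mem_singleton_iff.1 hzt).symm⟩

/-- In a strictly convex space, the fixed points of a quasi-nonexpansive self-map of a convex set
form a convex set. -/
theorem convex_fixedPoints_of_quasinonexpansive {X : Type*} [NormedAddCommGroup X]
    [NormedSpace ℝ X] [StrictConvexSpace ℝ X] {D : Set X} (hconv : Convex ℝ D) {t : X → X}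
    (hq : ∀ x ∈ D, t x = x → ∀ y ∈ D, ‖x - t y‖ ≤ ‖x - y‖) :
    Convex ℝ {x ∈ D | t x = x} := by
  rintro x ⟨hx, hxt⟩ y ⟨hy, hyt⟩ a b ha hb hab
  have hz := hconv hx hy ha hb hab
  refine ⟨hz, ?_⟩
  set z := a • x + b • y with hzdef
  by_contra hne
  have h1 : (1 / 2 : ℝ) • t z + (1 / 2 : ℝ) • z ∈ Metric.ball x ‖x - z‖ :=
    combo_mem_ball_of_ne (by rw [mem_closedBall_iff_norm']; exact hq x hx hxt z hz)
      (by rw [mem_closedBall_iff_norm']) hne (by norm_num) (by norm_num) (by norm_num)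
  have h2 : (1 / 2 : ℝ) • t z + (1 / 2 : ℝ) • z ∈ Metric.ball y ‖y - z‖ :=
    combo_mem_ball_of_ne (by rw [mem_closedBall_iff_norm']; exact hq y hy hyt z hz)
      (by rw [mem_closedBall_iff_norm']) hne (by norm_num) (by norm_num) (by norm_num)
  rw [mem_ball_iff_norm'] at h1 h2
  have hb' : b = 1 - a := by linarith
  have h3 : ‖x - z‖ = b * ‖x - y‖ := by
    rw [hzdef, hb', show x - (a • x + (1 - a) • y) = (1 - a) • (x - y) by module, ← hb', norm_smul,
      Real.norm_of_nonneg hb]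
  have h4 : ‖y - z‖ = a * ‖x - y‖ := by
    rw [hzdef, hb', show y - (a • x + (1 - a) • y) = a • (y - x) by module, norm_smul,
      Real.norm_of_nonneg ha, norm_sub_rev]
  have h5 := norm_sub_le_norm_sub_add_norm_sub x ((1 / 2 : ℝ) • t z + (1 / 2 : ℝ) • z) y
  rw [norm_sub_rev ((1 / 2 : ℝ) • t z + (1 / 2 : ℝ) • z) y] at h5
  rw [hb'] at h3
  linarith

/-- In a strictly convex space, a fixed point `a` of `t` has a nearest point in a `t`-invariant
compact convex set `K` which is itself fixed by `t`, provided `t` does not increase the distance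
from `a` to points of `K`. -/
theorem exists_fixedPoint_infDist_eq {X : Type*} [NormedAddCommGroup X]
    [NormedSpace ℝ X] [StrictConvexSpace ℝ X] {K : Set X} (hne : K.Nonempty) (hcp : IsCompact K)
    (hconv : Convex ℝ K) {t : X → X} (ht : Set.MapsTo t K K) {a : X}
    (hq : ∀ y ∈ K, ‖a - t y‖ ≤ ‖a - y‖) :
    ∃ b ∈ K, t b = b ∧ Metric.infDist a K = ‖a - b‖ := by
  obtain ⟨b, hb, hab⟩ := hcp.exists_infDist_eq_dist hne a
  rw [dist_eq_norm] at hab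
  refine ⟨b, hb, ?_, hab⟩
  by_contra hne
  have h1 : (1 / 2 : ℝ) • t b + (1 / 2 : ℝ) • b ∈ Metric.ball a ‖a - b‖ :=
    combo_mem_ball_of_ne (by rw [mem_closedBall_iff_norm']; exact hq b hb)
      (by rw [mem_closedBall_iff_norm']) hne (by norm_num) (by norm_num) (by norm_num)
  have h2 := Metric.infDist_le_dist_of_mem (x := a)
    (hconv (ht hb) hb (by norm_num : (0 : ℝ) ≤ 1 / 2) (by norm_num : (0 : ℝ) ≤ 1 / 2) (by norm_num))
  rw [Metric.mem_ball'] at h1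
  linarith


/-- Theorem 3.8: Let `D` be a nonempty compact convex subset of a
strictly convex Banach space, `t : D → D` a single-valued mapping and `T : D → KC(D)`
a multivalued mapping, both satisfying conditions (E) and `(C_λ)` for some
`λ ∈ (0,1)`, which commute. Then there exists `z ∈ D` with `z = t(z) ∈ T(z)`. -/
theorem common_fixed_point_compact_strictly_convex {X : Type*} [NormedAddCommGroup X]
    [NormedSpace ℝ X] [CompleteSpace X] [StrictConvexSpace ℝ X]
    (D : Set X) (hne : D.Nonempty) (hcp : IsCompact D) (hconv : Convex ℝ D)
    (t : X → X) (ht : Set.MapsTo t D D)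
    (T : X → Set X)
    (hTne : ∀ x ∈ D, (T x).Nonempty) (hTcp : ∀ x ∈ D, IsCompact (T x))
    (hTconv : ∀ x ∈ D, Convex ℝ (T x)) (hTsub : ∀ x ∈ D, T x ⊆ D)
    (l : ℝ) (hl : l ∈ Set.Ioo (0:ℝ) 1)
    (htC : ∀ x ∈ D, ∀ y ∈ D, l * ‖x - t x‖ ≤ ‖x - y‖ → ‖t x - t y‖ ≤ ‖x - y‖)
    (htE : ∃ μ : ℝ, 1 ≤ μ ∧ ∀ x ∈ D, ∀ y ∈ D, ‖x - t y‖ ≤ μ * ‖x - t x‖ + ‖x - y‖)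
    (hTC : ∀ x ∈ D, ∀ y ∈ D, l * Metric.infDist x (T x) ≤ ‖x - y‖ →
      Metric.hausdorffDist (T x) (T y) ≤ ‖x - y‖)
    (hTE : ∃ μ : ℝ, 1 ≤ μ ∧ ∀ x ∈ D, ∀ y ∈ D,
      Metric.infDist x (T y) ≤ μ * Metric.infDist x (T x) + ‖x - y‖)
    (hcomm : ∀ x ∈ D, ∀ y ∈ D, x ∈ T y → t y ∈ D → t x ∈ T (t y)) :
    ∃ z ∈ D, t z = z ∧ z ∈ T z := by
  obtain ⟨μ, -, htE⟩ := htE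
  obtain ⟨ν, hν, hTE⟩ := hTE
  have hq : ∀ x ∈ D, t x = x → ∀ y ∈ D, ‖x - t y‖ ≤ ‖x - y‖ := by
    intro x hx hxt y hy
    have h := htC x hx y hy (by rw [hxt, sub_self, norm_zero, mul_zero]; exact norm_nonneg _)
    rwa [hxt] at h
  set F : Set X := {x ∈ D | t x = x}
  have hFD : F ⊆ D := fun x hx => hx.1
  have hFne : F.Nonempty := exists_fixedPoint_of_conditionC_conditionE hne hcp hconv ht hl htC htE
  have hFcl : IsClosed F := by
    refine isClosed_of_closure_subset fun x hx => ?_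
    have hxD : x ∈ D := hcp.isClosed.closure_subset_iff.2 hFD hx
    obtain ⟨u, hu, hux⟩ := mem_closure_iff_seq_limit.1 hx
    have h : Tendsto u atTop (𝓝 (t x)) := by
      rw [tendsto_iff_norm_sub_tendsto_zero] at hux ⊢
      exact squeeze_zero (fun _ => norm_nonneg _) (fun n => hq _ (hu n).1 (hu n).2 x hxD) hux
    exact ⟨hxD, tendsto_nhds_unique h hux⟩
  have hinv : ∀ x ∈ F, Set.MapsTo t (T x) (T x) := by
    intro x hx a ha
    have h := hcomm a (hTsub x hx.1 ha) x hx.1 ha (ht hx.1)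
    rwa [hx.2] at h
  have hnear : ∀ a ∈ F, ∀ y ∈ F, ∃ b ∈ T y ∩ F, ‖a - b‖ = Metric.infDist a (T y) := by
    intro a ha y hy
    obtain ⟨b, hb, hbt, hab⟩ := exists_fixedPoint_infDist_eq (hTne y hy.1) (hTcp y hy.1)
      (hTconv y hy.1) (hinv y hy) fun z hz => hq a ha.1 ha.2 z (hTsub y hy.1 hz)
    exact ⟨b, ⟨hb, hTsub y hy.1 hb, hbt⟩, hab.symm⟩
  obtain ⟨z, hz, hzT⟩ := exists_mem_of_conditionC_conditionE (S := fun x => T x ∩ F) (μ := ν)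
    hFne (hcp.of_isClosed_subset hFcl hFD) (convex_fixedPoints_of_quasinonexpansive hconv hq)
    (fun x hx => (hnear x hx x hx).imp fun _ h => h.1)
    (fun x hx => (hTcp x hx.1).isClosed.inter hFcl) (fun _ _ => Set.inter_subset_right) hl
    (by
      intro x hx y hy a ha h
      obtain ⟨b, hb, hab⟩ := hnear a ha.2 y hy
      refine ⟨b, hb, ?_⟩
      have h1 : Metric.infDist x (T x) ≤ ‖x - a‖ := by
        rw [← dist_eq_norm]; exact Metric.infDist_le_dist_of_mem ha.1
      have h2 := hTC x hx.1 y hy.1 ((mul_le_mul_of_nonneg_left h1 hl.1.le).trans h)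
      rw [hab]
      exact (Metric.infDist_le_hausdorffDist_of_mem ha.1
        (Metric.hausdorffEDist_ne_top_of_nonempty_of_bounded (hTne x hx.1) (hTne y hy.1)
          (hTcp x hx.1).isBounded (hTcp y hy.1).isBounded)).trans h2)
    (by
      intro x hx y hy a ha
      obtain ⟨b, hb, hab⟩ := hnear x hx y hy
      refine ⟨b, hb, ?_⟩
      have h1 : Metric.infDist x (T x) ≤ ‖x - a‖ := by
        rw [← dist_eq_norm]; exact Metric.infDist_le_dist_of_mem ha.1
      rw [hab]
      exact (hTE x hx.1 y hy.1).trans (by gcongr))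
  exact ⟨z, hz.1, hz.2, hzT.1⟩
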